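/- arXiv:2108.03276 — 2 statements merged into one kernel-verified Lean document; each statement's English description precedes it below -/
import Mathlib

section
/- Let ν, μ ∈ ℂ with μ+1 not a nonpositive integer, and let x ∈ (1/√2, 1) (so that |1 − 1/x²| < 1). Then the Ferrers function of the first kind admits the hypergeometric representation 𝖯_ν^{−μ}(x) = (x^{ν−μ} (1−x²)^{μ/2} / (2^μ Γ(μ+1))) · ₂F₁((μ−ν)/2, (μ−ν+1)/2; μ+1; 1 − 1/x²). -/
/-- Pochhammer symbol `(a)_k = a (a+1) ⋯ (a+k-1)` for complex `a`. -/
noncomputable def cpoch (a : ℂ) (k : ℕ) : ℂ := ∏ i ∈ Finset.range k, (a + i)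

/-- Gauss hypergeometric series `₂F₁(a, b; c; z)`. -/
noncomputable def hyp2F1 (a b c z : ℂ) : ℂ :=
  ∑' k : ℕ, cpoch a k * cpoch b k / (cpoch c k * (Nat.factorial k : ℂ)) * z ^ k

/-- Ferrers function of the first kind `𝖯_ν^{−μ}(x)`. -/
noncomputable def ferrersP (ν μ : ℂ) (x : ℝ) : ℂ :=
  (1 / Complex.Gamma (μ + 1)) * (((1 - x) / (1 + x) : ℝ) : ℂ) ^ (μ / 2) *
    hyp2F1 (-ν) (ν + 1) (μ + 1) (((1 - x) / 2 : ℝ) : ℂ)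

open Filter Topology

theorem one_le_radius_ofScalars {f : ℕ → ℂ}
    (hf : ∀ z : ℂ, ‖z‖ < 1 → Summable fun n ↦ f n * z ^ n) :
    1 ≤ (FormalMultilinearSeries.ofScalars ℂ f).radius := by
  refine ENNReal.le_of_forall_nnreal_lt fun r hr ↦ ?_
  refine FormalMultilinearSeries.le_radius_of_summable _ ?_
  have hr' : ‖((r : ℝ) : ℂ)‖ < 1 := by
    simpa using hr
  simpa using (hf _ hr').norm

theorem hasSum_deriv_power_series {f : ℕ → ℂ}
    (hf : ∀ z : ℂ, ‖z‖ < 1 → Summable fun n ↦ f n * z ^ n) {z : ℂ} (hz : ‖z‖ < 1) :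
    HasSum (fun n ↦ (n + 1) * f (n + 1) * z ^ n) (deriv (fun w ↦ ∑' n, f n * w ^ n) z) ∧
      DifferentiableAt ℂ (fun w ↦ ∑' n, f n * w ^ n) z := by
  set p := FormalMultilinearSeries.ofScalars ℂ f
  have hp : 1 ≤ p.radius := one_le_radius_ofScalars hf
  have hsum : (fun w ↦ ∑' n, f n * w ^ n) = p.sum := by
    funext w
    exact tsum_congr fun n ↦ by simp [p, mul_comm]
  have hball : HasFPowerSeriesOnBall p.sum p 0 1 :=
    (p.hasFPowerSeriesOnBall (zero_lt_one.trans_le hp)).mono zero_lt_one hp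
  have hz' : z ∈ Metric.eball (0 : ℂ) 1 := by
    simpa [← ofReal_norm] using hz
  rw [hsum]
  refine ⟨?_, (hball.analyticAt_of_mem hz').differentiableAt⟩
  have h := (hball.fderiv.hasSum hz').mapL (ContinuousLinearMap.apply ℂ ℂ (1 : ℂ))
  simp only [zero_add, ContinuousLinearMap.apply_apply, fderiv_apply_one_eq_deriv] at h
  refine h.congr_fun ?_
  intro n
  have := p.derivSeries_coeff_one n
  rw [FormalMultilinearSeries.apply_eq_pow_smul_coeff]
  simp [this, p, FormalMultilinearSeries.coeff_ofScalars]
  ring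

theorem hasSum_nat_mul_of_hasSum_succ {f : ℕ → ℂ} {z s : ℂ}
    (h : HasSum (fun n : ℕ ↦ (n + 1) * f (n + 1) * z ^ n) s) :
    HasSum (fun n : ℕ ↦ n * f n * z ^ n) (z * s) := by
  rw [← hasSum_nat_add_iff' 1]
  simp only [Finset.range_one, Finset.sum_singleton, Nat.cast_zero, zero_mul, sub_zero]
  refine (h.mul_left z).congr_fun fun n ↦ ?_
  push_cast
  ring

theorem cpoch_succ (a : ℂ) (k : ℕ) : cpoch a (k + 1) = cpoch a k * (a + k) :=
  Finset.prod_range_succ _ _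

theorem cpoch_ne_zero {c : ℂ} (hc : ∀ k : ℕ, c ≠ -(k : ℂ)) (k : ℕ) : cpoch c k ≠ 0 :=
  Finset.prod_ne_zero_iff.2 fun i _ h ↦ hc i (eq_neg_of_add_eq_zero_left h)

/-- The coefficients of the Gauss hypergeometric series. -/
noncomputable def hypCoeff (a b c : ℂ) (k : ℕ) : ℂ :=
  cpoch a k * cpoch b k / (cpoch c k * (Nat.factorial k : ℂ))

theorem hypCoeff_succ {c : ℂ} (hc : ∀ k : ℕ, c ≠ -(k : ℂ)) (a b : ℂ) (k : ℕ) :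
    (k + 1) * (c + k) * hypCoeff a b c (k + 1) = (a + k) * (b + k) * hypCoeff a b c k := by
  have h1 := cpoch_ne_zero hc k
  have h2 : c + k ≠ 0 := fun h ↦ hc k (eq_neg_of_add_eq_zero_left h)
  have h3 : (k : ℂ) + 1 ≠ 0 := Nat.cast_add_one_ne_zero k
  have h4 : (k.factorial : ℂ) ≠ 0 := Nat.cast_ne_zero.2 k.factorial_ne_zero
  simp only [hypCoeff, cpoch_succ, Nat.factorial_succ]
  push_cast
  field_simp

theorem summable_hypCoeff {c : ℂ} (hc : ∀ k : ℕ, c ≠ -(k : ℂ)) (a b : ℂ) (z : ℂ) (hz : ‖z‖ < 1) :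
    Summable fun n ↦ hypCoeff a b c n * z ^ n := by
  obtain ⟨r, hr, hr1⟩ := exists_between hz
  refine summable_of_ratio_norm_eventually_le hr1 ?_
  have hlim : Tendsto (fun n : ℕ ↦ ‖(a + 1 * n) / (c + 1 * n) * ((b + 1 * n) / (1 + 1 * n)) * z‖)
      atTop (𝓝 ‖(1 : ℂ) / 1 * (1 / 1) * z‖) :=
    (((tendsto_add_mul_div_add_mul_atTop_nhds a c 1 one_ne_zero).mul
      (tendsto_add_mul_div_add_mul_atTop_nhds b 1 1 one_ne_zero)).mul_const z).norm
  filter_upwards [hlim.eventually_lt_const (by simpa using hr)] with n hn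
  have h2 : c + n ≠ 0 := fun h ↦ hc n (eq_neg_of_add_eq_zero_left h)
  have h3 : (n : ℂ) + 1 ≠ 0 := Nat.cast_add_one_ne_zero n
  have h3' : 1 + (n : ℂ) ≠ 0 := by rwa [add_comm]
  have key : hypCoeff a b c (n + 1) * z ^ (n + 1) =
      (a + 1 * n) / (c + 1 * n) * ((b + 1 * n) / (1 + 1 * n)) * z * (hypCoeff a b c n * z ^ n) := by
    have := hypCoeff_succ hc a b n
    simp only [one_mul]
    field_simp
    linear_combination z ^ (n + 1) * this
  rw [key, norm_mul]
  gcongr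

/-- The hypergeometric function is twice differentiable on the unit disc and satisfies the
hypergeometric differential equation there. -/
theorem hyp2F1_ode {c : ℂ} (hc : ∀ k : ℕ, c ≠ -(k : ℂ)) (a b : ℂ) :
    ∃ F₁ F₂ : ℂ → ℂ, ∀ z : ℂ, ‖z‖ < 1 →
      HasDerivAt (hyp2F1 a b c) (F₁ z) z ∧ HasDerivAt F₁ (F₂ z) z ∧
      z * (1 - z) * F₂ z + (c - (a + b + 1) * z) * F₁ z - a * b * hyp2F1 a b c z = 0 := by
  set f := hypCoeff a b c with hf
  have s0 := summable_hypCoeff hc a b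
  have d0 := fun z hz ↦ hasSum_deriv_power_series s0 (z := z) hz
  set g : ℕ → ℂ := fun n ↦ (n + 1) * f (n + 1) with hg
  have d1 := fun z hz ↦ hasSum_deriv_power_series (f := g) (fun w hw ↦ (d0 w hw).1.summable)
    (z := z) hz
  set F₁ : ℂ → ℂ := fun w ↦ ∑' n, g n * w ^ n with hF₁
  refine ⟨F₁, deriv F₁, fun z hz ↦ ?_⟩
  have e0 := (d0 z hz).1
  have e1 := (d1 z hz).1
  have h0 : HasDerivAt (hyp2F1 a b c) (F₁ z) z := by
    have : F₁ z = deriv (hyp2F1 a b c) z := e0.tsum_eq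
    rw [this]
    exact (d0 z hz).2.hasDerivAt
  have hD : deriv (fun w ↦ ∑' n, f n * w ^ n) z = F₁ z := h0.deriv
  rw [hD] at e0
  refine ⟨h0, (d1 z hz).2.hasDerivAt, ?_⟩
  have t0 : HasSum (fun n ↦ f n * z ^ n) (hyp2F1 a b c z) := (s0 z hz).hasSum
  have t1 := hasSum_nat_mul_of_hasSum_succ e0
  have t2 := hasSum_nat_mul_of_hasSum_succ e1
  have t3 : HasSum (fun n : ℕ ↦ n * ((n - 1) * f n) * z ^ n) (z * (z * deriv F₁ z)) := by
    apply hasSum_nat_mul_of_hasSum_succ (f := fun n ↦ (n - 1) * f n)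
    convert t2 using 2 with n
    simp only [hg]
    push_cast
    ring
  have tot := (((t2.sub t3).add (e0.mul_left c)).sub (t1.mul_left (a + b + 1))).sub
    (t0.mul_left (a * b))
  have hz0 := (tot.congr_fun (g := fun _ ↦ (0 : ℂ)) fun n ↦ ?_).unique hasSum_zero
  · linear_combination hz0
  have := hypCoeff_succ hc a b n
  simp only [hg, hf]
  linear_combination -z ^ n * this

theorem eventually_eq_zero_of_hypergeometric_ode {D D₁ D₂ : ℂ → ℂ} {c d e : ℂ}
    (hc : ∀ k : ℕ, c ≠ -(k : ℂ)) (hD : AnalyticAt ℂ D 0) (hD0 : D 0 = 0)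
    (h1 : ∀ᶠ z in 𝓝 0, HasDerivAt D (D₁ z) z) (h2 : ∀ᶠ z in 𝓝 0, HasDerivAt D₁ (D₂ z) z)
    (hode : ∀ᶠ z in 𝓝 0, z * (1 - z) * D₂ z + (c - d * z) * D₁ z - e * D z = 0) :
    ∀ᶠ z in 𝓝 0, D z = 0 := by
  by_contra hne
  obtain ⟨m, h, hh, hh0, hDh⟩ := hD.exists_eventuallyEq_pow_smul_nonzero_iff.2 hne
  simp only [sub_zero, smul_eq_mul] at hDh
  obtain ⟨k, rfl⟩ : ∃ k, m = k + 1 := by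
    refine Nat.exists_eq_succ_of_ne_zero fun hm ↦ hh0 ?_
    have := hDh.self_of_nhds
    simpa [hm, hD0] using this.symm
  set g : ℂ → ℂ := fun z ↦ (k + 1) * h z + z * deriv h z with hg
  have hga : AnalyticAt ℂ g 0 := by
    have := hh.deriv
    fun_prop
  have hD₁ : ∀ᶠ z in 𝓝 0, D₁ z = z ^ k * g z := by
    filter_upwards [h1, hDh.eventually_nhds, hh.eventually_analyticAt] with z hz hz' hhz
    have : HasDerivAt (fun z ↦ z ^ (k + 1) * h z) _ z :=
      (hasDerivAt_pow (k + 1) z).mul hhz.differentiableAt.hasDerivAt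
    rw [hz.unique (this.congr_of_eventuallyEq hz')]
    simp only [hg, Nat.add_sub_cancel]
    push_cast
    ring
  have hD₂ : ∀ᶠ z in 𝓝 0, z * D₂ z = z ^ k * (k * g z + z * deriv g z) := by
    filter_upwards [h2, hD₁.eventually_nhds, hga.eventually_analyticAt] with z hz hz' hgz
    have : HasDerivAt (fun z ↦ z ^ k * g z) _ z :=
      (hasDerivAt_pow k z).mul hgz.differentiableAt.hasDerivAt
    rw [hz.unique (this.congr_of_eventuallyEq hz')]
    rcases k with _ | k
    · simp
    · simp only [Nat.add_sub_cancel]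
      ring
  set Q : ℂ → ℂ := fun z ↦
    (1 - z) * (k * g z + z * deriv g z) + (c - d * z) * g z - e * (z * h z) with hQ
  have hQ0 : ∀ᶠ z in 𝓝[≠] 0, Q z = 0 := by
    filter_upwards [hode.filter_mono nhdsWithin_le_nhds, hD₁.filter_mono nhdsWithin_le_nhds,
      hD₂.filter_mono nhdsWithin_le_nhds, hDh.filter_mono nhdsWithin_le_nhds,
      self_mem_nhdsWithin] with z h0 h1 h2 h3 hz
    refine (mul_eq_zero.1 ?_).resolve_left (pow_ne_zero k hz)
    simp only [hQ]
    linear_combination h0 - (1 - z) * h2 - (c - d * z) * h1 + e * h3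
  have hQc : ContinuousAt Q 0 := by
    have h1 := hga.deriv.continuousAt
    have h2 := hga.continuousAt
    have h3 := hh.continuousAt
    fun_prop
  have : Q 0 = 0 := tendsto_nhds_unique (hQc.tendsto.mono_left nhdsWithin_le_nhds)
    (tendsto_const_nhds.congr' (hQ0.mono fun z hz ↦ hz.symm))
  simp only [hQ, hg] at this
  have h4 : ((k : ℂ) + 1) * (c + k) * h 0 = 0 := by linear_combination this
  have h5 : c + k ≠ 0 := fun h ↦ hc k (eq_neg_of_add_eq_zero_left h)
  simp [h5, hh0, Nat.cast_add_one_ne_zero] at h4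

theorem hasDerivAt_one_sub_mul_cpow (r s : ℂ) {t : ℂ} (ht : 1 - r * t ∈ Complex.slitPlane) :
    HasDerivAt (fun t ↦ (1 - r * t) ^ s) ((1 - r * t) ^ s * (-(r * s) / (1 - r * t))) t := by
  have h : HasDerivAt (fun t ↦ 1 - r * t) (-r) t := by
    simpa using ((hasDerivAt_id t).const_mul r).const_sub 1
  convert h.cpow_const (c := s) ht using 1
  rw [Complex.cpow_sub _ _ (Complex.slitPlane_ne_zero ht), Complex.cpow_one]
  ring

/-- The argument `1 - 1 / x ^ 2` as a function of `t = (1 - x) / 2`. -/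
noncomputable def quadArg (t : ℂ) : ℂ := 1 - 1 / (1 - 2 * t) ^ 2

/-- The candidate for the hypergeometric function `₂F₁(-ν, ν + 1; μ + 1; t)` obtained by a
quadratic transformation. -/
noncomputable def quadHyp (ν μ t : ℂ) : ℂ :=
  (1 - 1 * t) ^ μ * (1 - 2 * t) ^ (ν - μ) *
    hyp2F1 ((μ - ν) / 2) ((μ - ν + 1) / 2) (μ + 1) (quadArg t)

/-- A domain on which `quadHyp` is analytic. -/
def quadDomain : Set ℂ :=
  {t | 1 - 1 * t ∈ Complex.slitPlane ∧ 1 - 2 * t ∈ Complex.slitPlane ∧ ‖quadArg t‖ < 1}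

theorem hasDerivAt_quadArg {t : ℂ} (ht : 1 - 2 * t ≠ 0) :
    HasDerivAt quadArg (-4 / (1 - 2 * t) ^ 3) t := by
  have h : HasDerivAt (fun t : ℂ ↦ 1 - 2 * t) (-2) t := by
    simpa using ((hasDerivAt_id t).const_mul 2).const_sub 1
  have := ((hasDerivAt_const t (1 : ℂ)).div (h.pow 2) (pow_ne_zero 2 ht)).const_sub 1
  refine this.congr_deriv ?_
  simp only [Pi.pow_apply, Nat.cast_ofNat]
  field_simp
  ring

theorem isOpen_quadDomain : IsOpen quadDomain := by
  refine isOpen_iff_mem_nhds.2 fun t ⟨h1, h2, h3⟩ ↦ ?_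
  have c1 : ContinuousAt (fun t : ℂ ↦ 1 - 1 * t) t := by fun_prop
  have c2 : ContinuousAt (fun t : ℂ ↦ 1 - 2 * t) t := by fun_prop
  have c3 : ContinuousAt (fun t : ℂ ↦ ‖quadArg t‖) t :=
    (hasDerivAt_quadArg (Complex.slitPlane_ne_zero h2)).continuousAt.norm
  filter_upwards [c1.eventually_mem (Complex.isOpen_slitPlane.mem_nhds h1),
    c2.eventually_mem (Complex.isOpen_slitPlane.mem_nhds h2), c3.eventually_lt_const h3]
    with s a b c using ⟨a, b, c⟩

theorem quadHyp_ode_of_ode {ν μ t W h₀ h₁ h₂ : ℂ} (n1 : 1 - t ≠ 0) (n2 : 1 - 2 * t ≠ 0)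
    (ode : (1 - 1 / (1 - 2 * t) ^ 2) * (1 - (1 - 1 / (1 - 2 * t) ^ 2)) * h₂ +
        (μ + 1 - ((μ - ν) / 2 + (μ - ν + 1) / 2 + 1) * (1 - 1 / (1 - 2 * t) ^ 2)) * h₁ -
      (μ - ν) / 2 * ((μ - ν + 1) / 2) * h₀ = 0) :
    t * (1 - t) * (W * (-μ / (1 - t) + -(2 * (ν - μ)) / (1 - 2 * t)) *
          ((-μ / (1 - t) + -(2 * (ν - μ)) / (1 - 2 * t)) * h₀ + h₁ * (-4 / (1 - 2 * t) ^ 3)) +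
        W * ((-μ / (1 - t) ^ 2 + -4 * (ν - μ) / (1 - 2 * t) ^ 2) * h₀ +
          (-μ / (1 - t) + -(2 * (ν - μ)) / (1 - 2 * t)) * (h₁ * (-4 / (1 - 2 * t) ^ 3)) +
          (h₂ * (-4 / (1 - 2 * t) ^ 3) * (-4 / (1 - 2 * t) ^ 3) +
            h₁ * (-24 / (1 - 2 * t) ^ 4)))) +
      (μ + 1 - 2 * t) * (W * ((-μ / (1 - t) + -(2 * (ν - μ)) / (1 - 2 * t)) * h₀ +
        h₁ * (-4 / (1 - 2 * t) ^ 3))) +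
      ν * (ν + 1) * (W * h₀) = 0 := by
  have n3 : 1 - t * 2 ≠ 0 := by rwa [mul_comm]
  linear_combination (norm := skip) W * (-4 / (1 - 2 * t) ^ 2) * ode
  field_simp
  ring

/-- `quadHyp` satisfies the hypergeometric differential equation of `₂F₁(-ν, ν + 1; μ + 1; t)`. -/
theorem quadHyp_ode (ν : ℂ) {μ : ℂ} (hμ : ∀ k : ℕ, μ + 1 ≠ -(k : ℂ)) :
    ∃ G₁ G₂ : ℂ → ℂ, ∀ t ∈ quadDomain,
      HasDerivAt (quadHyp ν μ) (G₁ t) t ∧ HasDerivAt G₁ (G₂ t) t ∧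
      t * (1 - t) * G₂ t + (μ + 1 - 2 * t) * G₁ t + ν * (ν + 1) * quadHyp ν μ t = 0 := by
  obtain ⟨H₁, H₂, hH⟩ := hyp2F1_ode hμ ((μ - ν) / 2) ((μ - ν + 1) / 2)
  set H := hyp2F1 ((μ - ν) / 2) ((μ - ν + 1) / 2) (μ + 1) with hHdef
  set W : ℂ → ℂ := fun t ↦ (1 - 1 * t) ^ μ * (1 - 2 * t) ^ (ν - μ) with hW
  set w : ℂ → ℂ := fun t ↦ -μ / (1 - 1 * t) + -(2 * (ν - μ)) / (1 - 2 * t) with hw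
  set ζ' : ℂ → ℂ := fun t ↦ -4 / (1 - 2 * t) ^ 3 with hζ'
  refine ⟨fun t ↦ W t * (w t * H (quadArg t) + H₁ (quadArg t) * ζ' t),
    fun t ↦ W t * w t * (w t * H (quadArg t) + H₁ (quadArg t) * ζ' t) +
      W t * ((-μ / (1 - t) ^ 2 + -4 * (ν - μ) / (1 - 2 * t) ^ 2) * H (quadArg t) +
        w t * (H₁ (quadArg t) * ζ' t) +
        (H₂ (quadArg t) * ζ' t * ζ' t + H₁ (quadArg t) * (-24 / (1 - 2 * t) ^ 4))),
    fun t ⟨h1, h2, h3⟩ ↦ ?_⟩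
  obtain ⟨dH, dH₁, ode⟩ := hH _ h3
  have n1 := Complex.slitPlane_ne_zero h1
  have n2 := Complex.slitPlane_ne_zero h2
  have dζ := hasDerivAt_quadArg n2
  have dW : HasDerivAt W (W t * w t) t := by
    refine ((hasDerivAt_one_sub_mul_cpow 1 μ h1).mul
      (hasDerivAt_one_sub_mul_cpow 2 (ν - μ) h2)).congr_deriv ?_
    simp only [hW, hw]
    ring
  have l1 : HasDerivAt (fun t : ℂ ↦ 1 - 1 * t) (-1) t := by
    simpa using ((hasDerivAt_id t).const_mul 1).const_sub 1
  have l2 : HasDerivAt (fun t : ℂ ↦ 1 - 2 * t) (-2) t := by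
    simpa using ((hasDerivAt_id t).const_mul 2).const_sub 1
  have dw : HasDerivAt w (-μ / (1 - t) ^ 2 + -4 * (ν - μ) / (1 - 2 * t) ^ 2) t := by
    refine (((hasDerivAt_const t (-μ)).div l1 n1).add
      ((hasDerivAt_const t (-(2 * (ν - μ)))).div l2 n2)).congr_deriv ?_
    simp only [one_mul]
    ring
  have dζ' : HasDerivAt ζ' (-24 / (1 - 2 * t) ^ 4) t := by
    refine ((hasDerivAt_const t (-4 : ℂ)).div (l2.pow 3) (pow_ne_zero 3 n2)).congr_deriv ?_
    simp only [Pi.pow_apply, Nat.cast_ofNat]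
    field_simp
    ring
  have cH : HasDerivAt (fun t ↦ H (quadArg t)) (H₁ (quadArg t) * ζ' t) t := dH.comp t dζ
  have cH₁ : HasDerivAt (fun t ↦ H₁ (quadArg t)) (H₂ (quadArg t) * ζ' t) t := dH₁.comp t dζ
  refine ⟨?_, ?_, ?_⟩
  · exact (dW.mul cH).congr_deriv (by ring)
  · refine (dW.mul ((dw.mul cH).add (cH₁.mul dζ'))).congr_deriv ?_
    simp only [Pi.mul_apply, Pi.add_apply]
  · have hq : quadHyp ν μ t = W t * H (quadArg t) := rfl
    have n1' : 1 - t ≠ 0 := by simpa using n1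
    rw [hq]
    simp only [hw, hζ', one_mul]
    generalize H (quadArg t) = h₀ at ode ⊢
    generalize H₁ (quadArg t) = h₁ at ode ⊢
    generalize H₂ (quadArg t) = h₂ at ode ⊢
    generalize W t = W₀
    rw [quadArg] at ode
    exact quadHyp_ode_of_ode n1' n2 ode

theorem hyp2F1_zero (a b c : ℂ) : hyp2F1 a b c 0 = 1 := by
  rw [hyp2F1, tsum_eq_single 0 fun n hn ↦ by simp [hn]]
  simp [cpoch]

theorem zero_mem_quadDomain : (0 : ℂ) ∈ quadDomain := by
  simp [quadDomain, quadArg]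

theorem analyticAt_hyp2F1 {c : ℂ} (hc : ∀ k : ℕ, c ≠ -(k : ℂ)) (a b : ℂ) {z : ℂ} (hz : ‖z‖ < 1) :
    AnalyticAt ℂ (hyp2F1 a b c) z := by
  obtain ⟨F₁, F₂, hF⟩ := hyp2F1_ode hc a b
  refine Complex.analyticAt_iff_eventually_differentiableAt.2 ?_
  filter_upwards [continuous_norm.continuousAt.eventually_lt_const hz] with w hw
  exact (hF w hw).1.differentiableAt

theorem analyticAt_quadHyp (ν : ℂ) {μ : ℂ} (hμ : ∀ k : ℕ, μ + 1 ≠ -(k : ℂ)) {t : ℂ}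
    (ht : t ∈ quadDomain) : AnalyticAt ℂ (quadHyp ν μ) t := by
  obtain ⟨G₁, G₂, hG⟩ := quadHyp_ode ν hμ
  refine Complex.analyticAt_iff_eventually_differentiableAt.2 ?_
  filter_upwards [isOpen_quadDomain.mem_nhds ht] with w hw
  exact (hG w hw).1.differentiableAt

theorem hyp2F1_eventuallyEq_quadHyp (ν : ℂ) {μ : ℂ} (hμ : ∀ k : ℕ, μ + 1 ≠ -(k : ℂ)) :
    hyp2F1 (-ν) (ν + 1) (μ + 1) =ᶠ[𝓝 0] quadHyp ν μ := by
  obtain ⟨F₁, F₂, hF⟩ := hyp2F1_ode hμ (-ν) (ν + 1)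
  obtain ⟨G₁, G₂, hG⟩ := quadHyp_ode ν hμ
  have hF' : ∀ᶠ z : ℂ in 𝓝 0, ‖z‖ < 1 :=
    continuous_norm.continuousAt.eventually_lt_const (by simp)
  have hG' : ∀ᶠ z : ℂ in 𝓝 0, z ∈ quadDomain := isOpen_quadDomain.mem_nhds zero_mem_quadDomain
  refine (eventually_eq_zero_of_hypergeometric_ode (D := hyp2F1 (-ν) (ν + 1) (μ + 1) - quadHyp ν μ)
    (D₁ := F₁ - G₁) (D₂ := F₂ - G₂) (d := 2) (e := -(ν * (ν + 1))) hμ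
    ((analyticAt_hyp2F1 hμ _ _ (by simp)).sub (analyticAt_quadHyp ν hμ zero_mem_quadDomain))
    ?_ ?_ ?_ ?_).mono fun z hz ↦ sub_eq_zero.1 hz
  · simp [quadHyp, quadArg, hyp2F1_zero]
  · filter_upwards [hF', hG'] with z h1 h2 using (hF z h1).1.sub (hG z h2).1
  · filter_upwards [hF', hG'] with z h1 h2 using (hF z h1).2.1.sub (hG z h2).2.1
  · filter_upwards [hF', hG'] with z h1 h2
    simp only [Pi.sub_apply]
    linear_combination (hF z h1).2.2 - (hG z h2).2.2

theorem quadArg_ofReal (t : ℝ) : quadArg t = ((1 - 1 / (1 - 2 * t) ^ 2 : ℝ) : ℂ) := by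
  simp [quadArg]

theorem ofReal_mem_quadDomain {t x : ℝ} (ht : 0 ≤ t) (hx : 1 / √2 < x) (htx : x ≤ 1 - 2 * t) :
    (t : ℂ) ∈ quadDomain := by
  have hx0 : 0 < x := lt_trans (by positivity) hx
  have hx2 : 1 / 2 < x ^ 2 := by
    have := pow_lt_pow_left₀ hx (by positivity) two_ne_zero
    rwa [div_pow, one_pow, Real.sq_sqrt zero_le_two] at this
  have h1 : 1 / 2 < (1 - 2 * t) ^ 2 := hx2.trans_le (pow_le_pow_left₀ hx0.le htx 2)
  have h2 : (1 - 2 * t) ^ 2 ≤ 1 := pow_le_one₀ (by linarith) (by linarith)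
  refine ⟨?_, ?_, ?_⟩
  · exact_mod_cast Complex.ofReal_mem_slitPlane.2 (show 0 < 1 - 1 * t by linarith)
  · exact_mod_cast Complex.ofReal_mem_slitPlane.2 (show 0 < 1 - 2 * t by linarith)
  · rw [quadArg_ofReal, Complex.norm_real, Real.norm_eq_abs, abs_lt]
    have h3 : 1 / (1 - 2 * t) ^ 2 < 2 := by
      rw [div_lt_iff₀ (by linarith)]
      linarith
    have h4 : 0 < 1 / (1 - 2 * t) ^ 2 := one_div_pos.2 (by linarith)
    constructor <;> linarith

theorem hyp2F1_eq_quadHyp (ν : ℂ) {μ : ℂ} (hμ : ∀ k : ℕ, μ + 1 ≠ -(k : ℂ)) {t : ℝ}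
    (ht : 0 ≤ t) (htx : 1 / √2 < 1 - 2 * t) :
    hyp2F1 (-ν) (ν + 1) (μ + 1) t = quadHyp ν μ t := by
  have hpos : 0 < 1 / √2 := by positivity
  have hcoe (s : ℝ) : AnalyticAt ℝ (fun s : ℝ ↦ (s : ℂ)) s := Complex.ofRealCLM.analyticAt s
  have hF : AnalyticOnNhd ℝ (fun s : ℝ ↦ hyp2F1 (-ν) (ν + 1) (μ + 1) s) (Set.Icc 0 t) := by
    intro s hs
    have hs1 : ‖(s : ℂ)‖ < 1 := by
      rw [Complex.norm_real, Real.norm_eq_abs, abs_of_nonneg hs.1]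
      linarith [hs.2]
    exact (analyticAt_hyp2F1 hμ (-ν) (ν + 1) hs1).restrictScalars.fun_comp (hcoe s)
  have hG : AnalyticOnNhd ℝ (fun s : ℝ ↦ quadHyp ν μ s) (Set.Icc 0 t) := by
    intro s hs
    have hsq : (s : ℂ) ∈ quadDomain := ofReal_mem_quadDomain hs.1 htx (by linarith [hs.2])
    exact (analyticAt_quadHyp ν hμ hsq).restrictScalars.fun_comp (hcoe s)
  have h0 : Tendsto (fun s : ℝ ↦ (s : ℂ)) (𝓝 0) (𝓝 0) := by
    simpa using Complex.continuous_ofReal.tendsto 0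
  exact hF.eqOn_of_preconnected_of_eventuallyEq hG isPreconnected_Icc (Set.left_mem_Icc.2 ht)
    (h0.eventually (hyp2F1_eventuallyEq_quadHyp ν hμ)) (Set.right_mem_Icc.2 ht)

theorem ferrersP_hypergeometric_rep (ν μ : ℂ) (hμ : ∀ k : ℕ, μ + 1 ≠ -(k : ℂ))
    (x : ℝ) (hx : x ∈ Set.Ioo (1 / Real.sqrt 2) 1) :
    ferrersP ν μ x =
      (x : ℂ) ^ (ν - μ) * ((1 - x ^ 2 : ℝ) : ℂ) ^ (μ / 2) /
          ((2 : ℂ) ^ μ * Complex.Gamma (μ + 1)) *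
        hyp2F1 ((μ - ν) / 2) ((μ - ν + 1) / 2) (μ + 1) ((1 - 1 / x ^ 2 : ℝ) : ℂ) := by
  obtain ⟨hx0, hx1⟩ := hx
  have hxpos : 0 < x := lt_trans (by positivity) hx0
  have key := hyp2F1_eq_quadHyp ν hμ (t := (1 - x) / 2) (by linarith) (by linarith)
  have e1 : (1 : ℂ) - 1 * (((1 - x) / 2 : ℝ) : ℂ) = (((1 + x) / 2 : ℝ) : ℂ) := by
    push_cast
    ring
  have e2 : (1 : ℂ) - 2 * (((1 - x) / 2 : ℝ) : ℂ) = (x : ℂ) := by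
    push_cast
    ring
  have e3 : quadArg (((1 - x) / 2 : ℝ) : ℂ) = ((1 - 1 / x ^ 2 : ℝ) : ℂ) := by
    rw [quadArg, e2]
    push_cast
    rfl
  rw [ferrersP, key, quadHyp, e1, e2, e3]
  have hA : 0 ≤ 1 - x := by linarith
  have hB : 0 < 1 + x := by linarith
  have hBs : ((1 + x : ℝ) : ℂ) ^ (μ / 2) ≠ 0 := by
    simp [Complex.cpow_eq_zero_iff, -Complex.ofReal_add, hB.ne']
  have hBμ : ((1 + x : ℝ) : ℂ) ^ μ = ((1 + x : ℝ) : ℂ) ^ (μ / 2) * ((1 + x : ℝ) : ℂ) ^ (μ / 2) := by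
    rw [← Complex.cpow_add _ _ (Complex.ofReal_ne_zero.2 hB.ne'), add_halves]
  rw [Complex.ofReal_div (1 - x), Complex.div_cpow_ofReal_nonneg hA hB.le,
    Complex.ofReal_div (1 + x), Complex.div_cpow_ofReal_nonneg hB.le zero_le_two, hBμ,
    show 1 - x ^ 2 = (1 - x) * (1 + x) by ring, Complex.ofReal_mul,
    Complex.mul_cpow_ofReal_nonneg hA hB.le, Complex.ofReal_ofNat]
  field_simp
end

section
/- Let n ∈ ℕ₀, λ ∈ ℂ with λ+1 not a nonpositive integer and (2λ+1)_n ≠ 0, and let x ∈ (−1,1). Then 𝖯_{n+λ}^{−λ}(x) = (n!/(2λ+1)_n) · ((1−x²)^{λ/2}/(2^λ Γ(λ+1))) · C_n^{λ+1/2}(x). -/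
/-- Gegenbauer polynomial `C_n^λ(x)`. -/
noncomputable def gegenbauerC (n : ℕ) (lam : ℂ) (x : ℝ) : ℂ :=
  ∑ k ∈ Finset.range (n / 2 + 1),
    (-1) ^ k * cpoch lam (n - k) / ((Nat.factorial k : ℂ) * (Nat.factorial (n - 2 * k) : ℂ)) *
      (2 * (x : ℂ)) ^ (n - 2 * k)

open Filter Topology

theorem cpoch_zero (a : ℂ) : cpoch a 0 = 1 := by
  simp [cpoch]

theorem cpoch_succ_left (a : ℂ) (k : ℕ) : cpoch a (k + 1) = a * cpoch (a + 1) k := by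
  simp only [cpoch, Finset.prod_range_succ', Nat.cast_add, Nat.cast_one, Nat.cast_zero, add_zero]
  rw [mul_comm]
  congr 1
  exact Finset.prod_congr rfl fun i _ => by ring

theorem cpoch_ne_zero_s1 {a : ℂ} (ha : ∀ k : ℕ, a ≠ -(k : ℂ)) (k : ℕ) : cpoch a k ≠ 0 :=
  Finset.prod_ne_zero_iff.mpr fun i _ h => ha i (eq_neg_of_add_eq_zero_left h)

theorem cpoch_eq_ascPochhammer_eval (a : ℂ) (k : ℕ) :
    cpoch a k = (ascPochhammer ℂ k).eval a := by
  induction k with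
  | zero => simp [cpoch_zero]
  | succ k ih => rw [cpoch_succ, ih, ascPochhammer_succ_eval]

/-- The hypergeometric series converges absolutely on the open unit disc. -/
theorem summable_hyp2F1 (a b : ℂ) {c z : ℂ} (hc : ∀ k : ℕ, c ≠ -(k : ℂ)) (hz : ‖z‖ < 1) :
    Summable fun k : ℕ =>
      cpoch a k * cpoch b k / (cpoch c k * (Nat.factorial k : ℂ)) * z ^ k := by
  obtain ⟨r, hzr, hr⟩ := exists_between hz
  have hlim : Tendsto (fun k : ℕ => ‖(a + 1 * k) / (c + 1 * k) * ((b + 1 * k) / (1 + 1 * k)) * z‖)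
      atTop (𝓝 ‖z‖) := by
    have h := (((tendsto_add_mul_div_add_mul_atTop_nhds a c (1 : ℂ) one_ne_zero).mul
      (tendsto_add_mul_div_add_mul_atTop_nhds b 1 (1 : ℂ) one_ne_zero)).mul_const z).norm
    simpa only [div_one, one_mul] using h
  refine summable_of_ratio_norm_eventually_le hr ?_
  filter_upwards [hlim.eventually_le_const hzr] with k hk
  have hck : c + k ≠ 0 := fun h => hc k (eq_neg_of_add_eq_zero_left h)
  have hk1 : (1 : ℂ) + k ≠ 0 := by exact_mod_cast (by lia : 1 + k ≠ 0)
  have hcp := cpoch_ne_zero_s1 hc k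
  have hfac : (Nat.factorial k : ℂ) ≠ 0 := by exact_mod_cast k.factorial_ne_zero
  have hstep : cpoch a (k + 1) * cpoch b (k + 1) /
      (cpoch c (k + 1) * (Nat.factorial (k + 1) : ℂ)) * z ^ (k + 1) =
      ((a + 1 * k) / (c + 1 * k) * ((b + 1 * k) / (1 + 1 * k)) * z) *
        (cpoch a k * cpoch b k / (cpoch c k * (Nat.factorial k : ℂ)) * z ^ k) := by
    rw [cpoch_succ, cpoch_succ, cpoch_succ, Nat.factorial_succ]
    push_cast
    rw [add_comm (k : ℂ) 1]
    simp only [one_mul]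
    field_simp
    ring
  rw [hstep, norm_mul]
  exact mul_le_mul_of_nonneg_right hk (norm_nonneg _)

theorem legendre_hyp2F1_coeff_recurrence (ν : ℂ) {μ : ℂ} (hμ : ∀ k : ℕ, μ + 1 ≠ -(k : ℂ))
    (k : ℕ) :
    (ν + μ + 1) * (cpoch (-(ν + 1)) (k + 1) * cpoch (ν + 1 + 1) (k + 1) /
        (cpoch (μ + 1) (k + 1) * (Nat.factorial (k + 1) : ℂ))) =
      (2 * ν + 1) * (cpoch (-ν) (k + 1) * cpoch (ν + 1) (k + 1) /
          (cpoch (μ + 1) (k + 1) * (Nat.factorial (k + 1) : ℂ))) -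
        2 * (2 * ν + 1) * (cpoch (-ν) k * cpoch (ν + 1) k /
          (cpoch (μ + 1) k * (Nat.factorial k : ℂ))) -
        (ν - μ) * (cpoch (-(ν - 1)) (k + 1) * cpoch (ν - 1 + 1) (k + 1) /
          (cpoch (μ + 1) (k + 1) * (Nat.factorial (k + 1) : ℂ))) := by
  have hck (j : ℕ) : μ + 1 + j ≠ 0 := fun h => hμ j (eq_neg_of_add_eq_zero_left h)
  have hk1 (j : ℕ) : (j : ℂ) + 1 ≠ 0 := Nat.cast_add_one_ne_zero j
  cases k with
  | zero =>
    have h0 := hck 0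
    simp only [cpoch_succ, cpoch_zero, Nat.factorial, Nat.cast_zero, add_zero] at h0 ⊢
    field_simp
    ring
  | succ j =>
    have hcp := cpoch_ne_zero_s1 hμ j
    have hfac : (Nat.factorial j : ℂ) ≠ 0 := by exact_mod_cast j.factorial_ne_zero
    have h0 := hck j
    have h1 := hck (j + 1)
    have h2 := hk1 j
    have h3 := hk1 (j + 1)
    have e1 : cpoch (-(ν + 1)) (j + 2) = -(ν + 1) * (-ν * cpoch (-ν + 1) j) := by
      rw [cpoch_succ_left, cpoch_succ_left, neg_add_rev, neg_add_cancel_comm]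
    have e2 : cpoch (ν - 1 + 1) (j + 2) = ν * ((ν + 1) * cpoch (ν + 1 + 1) j) := by
      rw [sub_add_cancel, cpoch_succ_left, cpoch_succ_left]
    have e3 : cpoch (-(ν - 1)) (j + 2) =
        cpoch (-ν + 1) j * (-ν + 1 + j) * (-ν + 1 + (j + 1 : ℕ)) := by
      rw [cpoch_succ, cpoch_succ, neg_sub, sub_eq_neg_add]
    rw [e1, e2, e3, cpoch_succ (ν + 1 + 1), cpoch_succ (ν + 1 + 1), cpoch_succ_left (-ν) (j + 1),
      cpoch_succ_left (ν + 1) (j + 1), cpoch_succ (-ν + 1), cpoch_succ (ν + 1 + 1),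
      cpoch_succ_left (-ν) j, cpoch_succ_left (ν + 1) j, cpoch_succ (μ + 1) (j + 1),
      cpoch_succ (μ + 1) j, Nat.factorial_succ (j + 1), Nat.factorial_succ j]
    push_cast at h1 h3 ⊢
    field_simp
    ring

/-- Contiguous relation in the degree `ν` for the hypergeometric factor of the Ferrers function. -/
theorem legendre_hyp2F1_recurrence (ν : ℂ) {μ z : ℂ} (hμ : ∀ k : ℕ, μ + 1 ≠ -(k : ℂ))
    (hz : ‖z‖ < 1) :
    (ν + μ + 1) * hyp2F1 (-(ν + 1)) (ν + 1 + 1) (μ + 1) z =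
      (2 * ν + 1) * (1 - 2 * z) * hyp2F1 (-ν) (ν + 1) (μ + 1) z -
        (ν - μ) * hyp2F1 (-(ν - 1)) (ν - 1 + 1) (μ + 1) z := by
  have hs (κ : ℂ) := summable_hyp2F1 (-κ) (κ + 1) hμ hz
  have hs' (κ : ℂ) := (summable_nat_add_iff 1).mpr (hs κ)
  have hsplit (κ : ℂ) : hyp2F1 (-κ) (κ + 1) (μ + 1) z =
      1 + ∑' k : ℕ, cpoch (-κ) (k + 1) * cpoch (κ + 1) (k + 1) /
        (cpoch (μ + 1) (k + 1) * (Nat.factorial (k + 1) : ℂ)) * z ^ (k + 1) := by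
    rw [hyp2F1, (hs κ).tsum_eq_zero_add]
    simp [cpoch_zero]
  have key : (ν + μ + 1) * (hyp2F1 (-(ν + 1)) (ν + 1 + 1) (μ + 1) z - 1) =
      (2 * ν + 1) * (hyp2F1 (-ν) (ν + 1) (μ + 1) z - 1) -
        2 * (2 * ν + 1) * z * hyp2F1 (-ν) (ν + 1) (μ + 1) z -
        (ν - μ) * (hyp2F1 (-(ν - 1)) (ν - 1 + 1) (μ + 1) z - 1) := by
    rw [hsplit (ν + 1), hsplit (ν - 1)]
    nth_rw 1 [hsplit ν]
    simp only [add_sub_cancel_left]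
    rw [hyp2F1, ← tsum_mul_left, ← tsum_mul_left, ← tsum_mul_left, ← tsum_mul_left,
      ← ((hs' ν).mul_left _).tsum_sub ((hs ν).mul_left _),
      ← (((hs' ν).mul_left _).sub ((hs ν).mul_left _)).tsum_sub ((hs' (ν - 1)).mul_left _)]
    refine tsum_congr fun k => ?_
    linear_combination z ^ (k + 1) * legendre_hyp2F1_coeff_recurrence ν hμ k
  linear_combination key

/-- The three-term recurrence in the degree for the Ferrers function of the first kind. -/
theorem ferrersP_recurrence (ν : ℂ) {μ : ℂ} (hμ : ∀ k : ℕ, μ + 1 ≠ -(k : ℂ)) {x : ℝ}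
    (hx : x ∈ Set.Ioo (-1 : ℝ) 1) :
    (ν + μ + 1) * ferrersP (ν + 1) μ x =
      (2 * ν + 1) * x * ferrersP ν μ x - (ν - μ) * ferrersP (ν - 1) μ x := by
  have hz : ‖(((1 - x) / 2 : ℝ) : ℂ)‖ < 1 := by
    rw [Complex.norm_real, Real.norm_eq_abs, abs_lt]
    constructor <;> linarith [hx.1, hx.2]
  have hx' : (1 : ℂ) - 2 * (((1 - x) / 2 : ℝ) : ℂ) = x := by
    push_cast
    ring
  have h := legendre_hyp2F1_recurrence ν hμ hz
  rw [hx'] at h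
  simp only [ferrersP]
  linear_combination
    (1 / Complex.Gamma (μ + 1)) * (((1 - x) / (1 + x) : ℝ) : ℂ) ^ (μ / 2) * h

/-- The hypergeometric series reduces to the binomial series when a parameter cancels. -/
theorem hyp2F1_cancel (a : ℂ) {b z : ℂ} (hb : ∀ k : ℕ, b ≠ -(k : ℂ)) (hz : ‖z‖ < 1) :
    hyp2F1 (-a) b b z = (1 - z) ^ a := by
  have h := (Complex.one_div_one_sub_cpow_hasFPowerSeriesOnBall_zero (-a)).hasSum
    (y := z) (by simpa [← ofReal_norm] using hz)
  rw [hyp2F1]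
  simp only [zero_add, Complex.cpow_neg, one_div, inv_inv] at h
  rw [← h.tsum_eq]
  refine tsum_congr fun k => ?_
  have hfac : (Nat.factorial k : ℂ) ≠ 0 := by exact_mod_cast k.factorial_ne_zero
  have hm := Ring.factorial_nsmul_multichoose_eq_ascPochhammer (-a) k
  rw [Polynomial.ascPochhammer_smeval_eq_eval, ← cpoch_eq_ascPochhammer_eval, nsmul_eq_mul] at hm
  have hbk := cpoch_ne_zero_s1 hb k
  simp only [FormalMultilinearSeries.ofScalars_apply_eq, smul_eq_mul, Ring.choose]
  rw [show -a + k - 1 - k + 1 = -a by ring, ← hm]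
  field_simp

/-- The `k`-th summand of `gegenbauerC n lam x`, extended by zero to all `k`. -/
noncomputable def gegenbauerTerm (n : ℕ) (lam : ℂ) (x : ℝ) (k : ℕ) : ℂ :=
  if 2 * k ≤ n then
    (-1) ^ k * cpoch lam (n - k) / ((Nat.factorial k : ℂ) * (Nat.factorial (n - 2 * k) : ℂ)) *
      (2 * (x : ℂ)) ^ (n - 2 * k)
  else 0

theorem gegenbauerC_eq_sum_gegenbauerTerm {n N : ℕ} (hN : n < 2 * N) (lam : ℂ) (x : ℝ) :
    gegenbauerC n lam x = ∑ k ∈ Finset.range N, gegenbauerTerm n lam x k := by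
  have hsub : Finset.range (n / 2 + 1) ⊆ Finset.range N :=
    Finset.range_subset_range.mpr (by lia)
  rw [gegenbauerC, ← Finset.sum_subset hsub]
  · refine Finset.sum_congr rfl fun k hk => ?_
    rw [gegenbauerTerm, if_pos (by rw [Finset.mem_range] at hk; lia)]
  · intro k _ hk
    rw [gegenbauerTerm, if_neg (by rw [Finset.mem_range] at hk; lia)]

theorem gegenbauerTerm_recurrence_zero (n : ℕ) (lam : ℂ) (x : ℝ) :
    (n + 1 : ℂ) * gegenbauerTerm (n + 1) lam x 0 =
      2 * (n + lam) * x * gegenbauerTerm n lam x 0 := by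
  have hn : (n : ℂ) + 1 ≠ 0 := Nat.cast_add_one_ne_zero n
  have hfac : (Nat.factorial n : ℂ) ≠ 0 := by exact_mod_cast n.factorial_ne_zero
  simp only [gegenbauerTerm, mul_zero, zero_le, if_true, Nat.sub_zero, cpoch_succ,
    Nat.factorial_succ, Nat.factorial_zero, pow_zero, pow_succ]
  push_cast
  field_simp
  ring

theorem gegenbauerTerm_recurrence_succ (n : ℕ) (lam : ℂ) (x : ℝ) (k : ℕ) :
    (n + 2 : ℂ) * gegenbauerTerm (n + 2) lam x (k + 1) =
      2 * (n + 1 + lam) * x * gegenbauerTerm (n + 1) lam x (k + 1) -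
        (n + 2 * lam) * gegenbauerTerm n lam x k := by
  have hk : (k : ℂ) + 1 ≠ 0 := Nat.cast_add_one_ne_zero k
  have hkfac : (Nat.factorial k : ℂ) ≠ 0 := by exact_mod_cast k.factorial_ne_zero
  rcases lt_trichotomy n (2 * k) with h | rfl | h
  · simp only [gegenbauerTerm]
    rw [if_neg (by lia), if_neg (by lia), if_neg (by lia)]
    ring
  · simp only [gegenbauerTerm]
    rw [if_pos (by lia), if_neg (by lia), if_pos le_rfl,
      show 2 * k + 2 - (k + 1) = k + 1 by lia, show 2 * k + 2 - 2 * (k + 1) = 0 by lia,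
      show 2 * k - k = k by lia, Nat.sub_self, cpoch_succ, Nat.factorial_succ]
    push_cast
    field_simp
    ring
  · obtain ⟨j, rfl⟩ : ∃ j, n = 2 * k + 1 + j := ⟨n - (2 * k + 1), by lia⟩
    have hj : (j : ℂ) + 1 ≠ 0 := Nat.cast_add_one_ne_zero j
    have hjfac : (Nat.factorial j : ℂ) ≠ 0 := by exact_mod_cast j.factorial_ne_zero
    simp only [gegenbauerTerm]
    rw [if_pos (by lia), if_pos (by lia), if_pos (by lia),
      show 2 * k + 1 + j + 2 - (k + 1) = k + j + 1 + 1 by lia,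
      show 2 * k + 1 + j + 2 - 2 * (k + 1) = j + 1 by lia,
      show 2 * k + 1 + j + 1 - (k + 1) = k + j + 1 by lia,
      show 2 * k + 1 + j + 1 - 2 * (k + 1) = j by lia,
      show 2 * k + 1 + j - k = k + j + 1 by lia,
      show 2 * k + 1 + j - 2 * k = j + 1 by lia, cpoch_succ lam (k + j + 1),
      Nat.factorial_succ, Nat.factorial_succ]
    push_cast
    field_simp
    ring

/-- The three-term recurrence for Gegenbauer polynomials. -/
theorem gegenbauerC_recurrence (n : ℕ) (lam : ℂ) (x : ℝ) :
    (n + 2 : ℂ) * gegenbauerC (n + 2) lam x =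
      2 * (n + 1 + lam) * x * gegenbauerC (n + 1) lam x -
        (n + 2 * lam) * gegenbauerC n lam x := by
  rw [gegenbauerC_eq_sum_gegenbauerTerm (n := n + 2) (N := n + 1 + 1) (by lia),
    gegenbauerC_eq_sum_gegenbauerTerm (n := n + 1) (N := n + 1 + 1) (by lia),
    gegenbauerC_eq_sum_gegenbauerTerm (n := n) (N := n + 1) (by lia),
    Finset.sum_range_succ', Finset.sum_range_succ' (gegenbauerTerm (n + 1) lam x)]
  have h0 := gegenbauerTerm_recurrence_zero (n + 1) lam x
  have hs := Finset.sum_congr (rfl : Finset.range (n + 1) = _)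
    fun k _ => gegenbauerTerm_recurrence_succ n lam x k
  rw [Finset.sum_sub_distrib, ← Finset.mul_sum, ← Finset.mul_sum, ← Finset.mul_sum] at hs
  push_cast at h0
  linear_combination h0 + hs

theorem gegenbauerC_zero (lam : ℂ) (x : ℝ) : gegenbauerC 0 lam x = 1 := by
  simp [gegenbauerC, cpoch_zero]

theorem gegenbauerC_one (lam : ℂ) (x : ℝ) : gegenbauerC 1 lam x = 2 * lam * x := by
  simp [gegenbauerC, cpoch_succ, cpoch_zero]
  ring

/-- The Ferrers function `𝖯_λ^{−λ}` in closed form. -/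
theorem ferrersP_self {lam : ℂ} (hlam : ∀ k : ℕ, lam + 1 ≠ -(k : ℂ)) {x : ℝ}
    (hx : x ∈ Set.Ioo (-1 : ℝ) 1) :
    ferrersP lam lam x =
      ((1 - x ^ 2 : ℝ) : ℂ) ^ (lam / 2) / ((2 : ℂ) ^ lam * Complex.Gamma (lam + 1)) := by
  have hp : 0 < 1 + x := by linarith [hx.1]
  have hm : 0 < 1 - x := by linarith [hx.2]
  have hz : ‖(((1 - x) / 2 : ℝ) : ℂ)‖ < 1 := by
    rw [Complex.norm_real, Real.norm_eq_abs, abs_lt]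
    constructor <;> linarith
  have h2 : (2 : ℂ) ^ lam ≠ 0 := by simp [Complex.cpow_eq_zero_iff]
  have hsq : ((1 - x ^ 2 : ℝ) : ℂ) ^ (lam / 2) =
      (((1 - x) / (1 + x) : ℝ) : ℂ) ^ (lam / 2) * ((1 + x : ℝ) : ℂ) ^ lam := by
    have hfac : 1 - x ^ 2 = (1 - x) / (1 + x) * ((1 + x) * (1 + x)) := by
      field_simp
      ring
    rw [hfac, Complex.ofReal_mul, Complex.mul_cpow_ofReal_nonneg (by positivity) (by positivity),
      Complex.ofReal_mul, Complex.mul_cpow_ofReal_nonneg hp.le hp.le,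
      ← Complex.cpow_add _ _ (by exact_mod_cast hp.ne'), add_halves]
  have hhalf : (2 : ℂ) ^ lam * (1 - (((1 - x) / 2 : ℝ) : ℂ)) ^ lam =
      ((1 + x : ℝ) : ℂ) ^ lam := by
    have h := Complex.mul_cpow_ofReal_nonneg (a := 2) (b := (1 + x) / 2) (by positivity)
      (by positivity) lam
    rw [← Complex.ofReal_mul, mul_div_cancel₀ _ two_ne_zero] at h
    rw [h]
    congr 2
    push_cast
    ring
  rw [ferrersP, hyp2F1_cancel lam hlam hz, hsq, ← hhalf]
  field_simp

theorem ferrersP_eq_gegenbauer (n : ℕ) (lam : ℂ) (hlam : ∀ k : ℕ, lam + 1 ≠ -(k : ℂ))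
    (hpoch : cpoch (2 * lam + 1) n ≠ 0) (x : ℝ) (hx : x ∈ Set.Ioo (-1 : ℝ) 1) :
    ferrersP ((n : ℂ) + lam) lam x =
      ((Nat.factorial n : ℂ) / cpoch (2 * lam + 1) n) *
        (((1 - x ^ 2 : ℝ) : ℂ) ^ (lam / 2) / ((2 : ℂ) ^ lam * Complex.Gamma (lam + 1))) *
        gegenbauerC n (lam + 1 / 2) x := by
  set K := ((1 - x ^ 2 : ℝ) : ℂ) ^ (lam / 2) / ((2 : ℂ) ^ lam * Complex.Gamma (lam + 1)) with hK
  clear_value K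
  induction n using Nat.twoStepInduction with
  | zero =>
    simp [gegenbauerC_zero, cpoch_zero, ferrersP_self hlam hx, hK]
  | one =>
    have h := ferrersP_recurrence lam hlam hx
    rw [sub_self, zero_mul, sub_zero, ferrersP_self hlam hx, ← hK] at h
    have hne : 2 * lam + 1 ≠ 0 := by simpa [cpoch] using hpoch
    simp only [gegenbauerC_one, cpoch_succ, cpoch_zero, Nat.factorial_one, Nat.cast_one,
      Nat.cast_zero, add_zero, one_mul]
    rw [add_comm 1 lam, div_mul_eq_mul_div, div_mul_eq_mul_div, eq_div_iff hne]
    linear_combination h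
  | more n ih₀ ih₁ =>
    rw [cpoch_succ] at hpoch
    have h₁ := left_ne_zero_of_mul hpoch
    have h₁' := right_ne_zero_of_mul hpoch
    rw [cpoch_succ] at h₁
    have h₀ := left_ne_zero_of_mul h₁
    have h₀' := right_ne_zero_of_mul h₁
    have hP := ferrersP_recurrence ((n + 1 : ℕ) + lam) hlam hx
    rw [show ((n + 1 : ℕ) : ℂ) + lam + 1 = (n + 2 : ℕ) + lam by push_cast; ring,
      show ((n + 1 : ℕ) : ℂ) + lam - 1 = n + lam by push_cast; ring, ih₀ h₀,
      ih₁ (by rwa [cpoch_succ])] at hP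
    have hn : (n : ℂ) + 2 ≠ 0 := by exact_mod_cast (by lia : n + 2 ≠ 0)
    have hC := eq_div_of_mul_eq hn
      ((mul_comm _ _).trans (gegenbauerC_recurrence n (lam + 1 / 2) x))
    refine mul_left_cancel₀ h₁' ?_
    rw [hC, cpoch_succ, cpoch_succ, Nat.factorial_succ (n + 1), Nat.factorial_succ n]
    rw [cpoch_succ, Nat.factorial_succ n] at hP
    push_cast at hP h₀' h₁' ⊢
    refine Eq.trans (by ring) (hP.trans ?_)
    field_simp
    ring
end
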